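/- Let N be a positive integer and let A be a real symmetric N×N matrix that is diagonally dominant with nonnegative diagonal, i.e., for every k, A_{kk} ≥ ∑_{j≠k} |A_{kj}|. Then for every vector u ∈ ℝ^N, ∑_{i=1}^{N} ∑_{j=1}^{N} u_i^3 u_j A_{ij} ≥ 0; equivalently, −∑_{i,j} u_i^3 u_j A_{ij} ≤ 0. -/

import Mathlib

open Finset

theorem young_aux (a b : ℝ) : |a ^ 3 * b| ≤ 3 / 4 * a ^ 4 + 1 / 4 * b ^ 4 := by
  rw [abs_le]
  constructor
  · nlinarith [mul_nonneg (sq_nonneg (a + b)) (add_nonneg (sq_nonneg (a - b)) (mul_nonneg zero_le_two (sq_nonneg a)))]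
  · nlinarith [mul_nonneg (sq_nonneg (a - b)) (add_nonneg (sq_nonneg (a + b)) (mul_nonneg zero_le_two (sq_nonneg a)))]

theorem stmt_1 (N : ℕ) (hN : 0 < N) (A : Matrix (Fin N) (Fin N) ℝ)
    (hA : A.IsSymm)
    (hdom : ∀ k : Fin N, ∑ j ∈ Finset.univ.erase k, |A k j| ≤ A k k)
    (u : Fin N → ℝ) :
    0 ≤ ∑ i : Fin N, ∑ j : Fin N, u i ^ 3 * u j * A i j ∧
      -∑ i : Fin N, ∑ j : Fin N, u i ^ 3 * u j * A i j ≤ 0 := by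
  suffices h : 0 ≤ ∑ i : Fin N, ∑ j : Fin N, u i ^ 3 * u j * A i j from ⟨h, by linarith⟩
  let B : Fin N → Fin N → ℝ := fun i j => if i = j then 0 else |A i j|
  have hBs : ∀ i j, B i j = B j i := by
    intro i j
    simp only [B, hA.apply i j, eq_comm]
  have hB : ∀ i, ∑ j, B i j ≤ A i i := by
    intro i
    refine le_trans (le_of_eq ?_) (hdom i)
    rw [← Finset.add_sum_erase _ _ (Finset.mem_univ i)]
    simp only [B, if_true, zero_add]
    refine Finset.sum_congr rfl fun j hj => ?_
    rw [if_neg (Finset.ne_of_mem_erase hj).symm]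
  have hterm : ∀ i j, (if i = j then A i i * u i ^ 4 else 0)
      - 3 / 4 * (B i j * u i ^ 4) - 1 / 4 * (B i j * u j ^ 4) ≤ u i ^ 3 * u j * A i j := by
    intro i j
    by_cases hij : i = j
    · subst hij
      simp only [B, if_true]
      apply le_of_eq
      ring
    · simp only [B, if_neg hij]
      have h1 := mul_le_mul_of_nonneg_left (young_aux (u i) (u j)) (abs_nonneg (A i j))
      have h2 := neg_abs_le (u i ^ 3 * u j * A i j)
      rw [abs_mul] at h2
      linarith
  have hswap : ∑ i, ∑ j, B i j * u j ^ 4 = ∑ i, ∑ j, B i j * u i ^ 4 := by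
    rw [Finset.sum_comm]
    exact Finset.sum_congr rfl fun i _ => Finset.sum_congr rfl fun j _ => by rw [hBs]
  have hsum := Finset.sum_le_sum fun i (_ : i ∈ Finset.univ) =>
    Finset.sum_le_sum fun j (_ : j ∈ Finset.univ) => hterm i j
  refine le_trans ?_ hsum
  simp only [Finset.sum_sub_distrib, ← Finset.mul_sum, hswap]
  have hfin : ∑ i, ∑ j, B i j * u i ^ 4 ≤ ∑ i, A i i * u i ^ 4 := by
    refine Finset.sum_le_sum fun i _ => ?_
    rw [← Finset.sum_mul]
    exact mul_le_mul_of_nonneg_right (hB i) (by positivity)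
  simp only [Finset.sum_ite_eq, Finset.mem_univ, if_true]
  linarith
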